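/- For all integers n, m with 2 ≤ m ≤ n−2, b(n,m) = Σ_{j=m}^{n−1} ((m−1)/(n+m−j−2))·binomial(2n+m−2j−4, n−j−1)·(binomial(j, m) − 1), where the equality holds in the rational numbers. -/

import Mathlib

/-- A Catalan word: a word `a : Fin n → ℕ` satisfying (i) `a (i+1) ≥ a i - 1` for all
adjacent positions, and (ii) if `i` is the minimal index with `a i = k > 0`, then there
exist `i₁ < i < i₂` with `a i₁ = a i₂ = k - 1`. -/
def IsCatalanWord {n : ℕ} (a : Fin n → ℕ) : Prop :=
  (∀ (i : ℕ) (h : i + 1 < n), a ⟨i, Nat.lt_of_succ_lt h⟩ ≤ a ⟨i + 1, h⟩ + 1) ∧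
  (∀ i : Fin n, 0 < a i → (∀ j : Fin n, a j = a i → i ≤ j) →
    ((∃ i₁ : Fin n, i₁ < i ∧ a i₁ + 1 = a i) ∧ (∃ i₂ : Fin n, i < i₂ ∧ a i₂ + 1 = a i)))

/-- The number of letters of the word `a` equal to `c`. -/
noncomputable def countEq {n : ℕ} (a : Fin n → ℕ) (c : ℕ) : ℕ :=
  Set.ncard {i : Fin n | a i = c}

/-- `bO n m` is the number of Catalan words of length `n` with exactly `m` ones. -/
noncomputable def bO (n m : ℕ) : ℕ :=
  Set.ncard {a : Fin n → ℕ | IsCatalanWord a ∧ countEq a 1 = m}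

/-- The ballot numbers: `ballot r k` is the coefficient of `x ^ k` in the `r`-th power of the
generating function of the Catalan numbers. -/
def ballot : ℕ → ℕ → ℕ
  | 0, 0 => 1
  | 0, _ + 1 => 0
  | _ + 1, 0 => 1
  | r + 1, k + 1 => ballot r (k + 1) + ballot (r + 2) k
termination_by r k => (k, r)

theorem ballot_zero_right (r : ℕ) : ballot r 0 = 1 := by
  cases r <;> simp [ballot]

theorem sum_multichoose_mul_ballot (k a r : ℕ) :
    ∑ q ∈ Finset.range (k + 1), Nat.multichoose r q * ballot (q + a) (k - q) =
      ballot (r + a) k := by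
  induction k generalizing a r with
  | zero => simp [ballot_zero_right]
  | succ k ihk =>
    induction r with
    | zero => simp [Finset.sum_range_succ']
    | succ r ihr =>
      have h := ihk (a + 1) (r + 1)
      rw [Finset.sum_range_succ'] at ihr ⊢
      simp only [Nat.multichoose_succ_succ, add_mul, Finset.sum_add_distrib]
      rw [show r + 1 + a = (r + a) + 1 by ring, ballot, ← ihr,
        show r + a + 2 = r + 1 + (a + 1) by ring, ← h]
      simp only [Nat.multichoose_zero_right, Nat.add_sub_add_right, add_assoc, add_comm 1 a]
      ring

theorem sum_multichoose_sub_one_mul_ballot (r k : ℕ) :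
    ∑ p ∈ Finset.range (k + 1), (Nat.multichoose (p + 2) r - 1) * ballot p (k - p) =
      ballot r (k + 1) := by
  induction r with
  | zero => simp [ballot]
  | succ r ih =>
    rw [ballot, ← ih, ← sum_multichoose_mul_ballot k 0 (r + 2), ← Finset.sum_add_distrib]
    refine Finset.sum_congr rfl fun p _ => ?_
    have h1 : Nat.multichoose (p + 2) (r + 1) =
        Nat.multichoose (r + 2) p + Nat.multichoose (p + 2) r := by
      rw [Nat.multichoose_succ_succ, Nat.multichoose_eq (p + 1), Nat.multichoose_eq (r + 2),
        show p + 1 + (r + 1) - 1 = p + (r + 1) by omega,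
        show r + 2 + p - 1 = p + (r + 1) by omega, Nat.choose_symm_add]
    have h2 : 0 < Nat.multichoose (p + 2) r := by
      rw [Nat.multichoose_eq]
      exact Nat.choose_pos (by omega)
    rw [h1, add_zero, Nat.add_sub_assoc h2, add_mul, add_comm]

theorem ballot_succ_succ_add_choose (r k : ℕ) :
    ballot (r + 1) (k + 1) + (2 * k + r + 2).choose k = (2 * k + r + 2).choose (k + 1) := by
  induction k generalizing r with
  | zero =>
    simp only [ballot, ballot_zero_right]
    induction r with
    | zero => simp [ballot]
    | succ r ih => simp [ballot, ballot_zero_right] at ih ⊢; omega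
  | succ k ihk =>
    induction r with
    | zero =>
      have h := ihk 1
      have h1 : (2 * (k + 1) + 0 + 2).choose (k + 1) =
        (2 * k + 3).choose k + (2 * k + 3).choose (k + 1) := Nat.choose_succ_succ _ _
      have h2 : (2 * (k + 1) + 0 + 2).choose (k + 1 + 1) =
        (2 * k + 3).choose (k + 1) + (2 * k + 3).choose (k + 1 + 1) := Nat.choose_succ_succ _ _
      have h3 : (2 * k + 3).choose (k + 1) = (2 * k + 3).choose (k + 1 + 1) :=
        Nat.choose_symm_of_eq_add (by ring)
      simp only [ballot] at h ⊢
      rw [show 2 * k + 1 + 2 = 2 * k + 3 by ring] at h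
      omega
    | succ r ihr =>
      have h := ihk (r + 2)
      rw [ballot]
      have h1 : (2 * (k + 1) + (r + 1) + 2).choose (k + 1) =
        (2 * (k + 1) + r + 2).choose k + (2 * (k + 1) + r + 2).choose (k + 1) :=
        Nat.choose_succ_succ _ _
      have h2 : (2 * (k + 1) + (r + 1) + 2).choose (k + 1 + 1) =
        (2 * (k + 1) + r + 2).choose (k + 1) + (2 * (k + 1) + r + 2).choose (k + 1 + 1) :=
        Nat.choose_succ_succ _ _
      rw [show 2 * k + (r + 2) + 2 = 2 * (k + 1) + r + 2 by ring] at h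
      rw [show r + 1 + 2 = r + 2 + 1 by ring]
      omega

theorem ballot_succ_cast (r k : ℕ) :
    (ballot (r + 1) k : ℚ) = ((r : ℚ) + 1) / ((k : ℚ) + r + 1) * (2 * k + r).choose k := by
  cases k with
  | zero =>
    have : (r : ℚ) + 1 ≠ 0 := by positivity
    simp [ballot_zero_right, this]
  | succ k =>
    have h := ballot_succ_succ_add_choose r k
    have h2 := Nat.choose_succ_right_eq (2 * k + r + 2) k
    rw [show 2 * k + r + 2 - k = k + r + 2 by omega] at h2
    have h' : (ballot (r + 1) (k + 1) : ℚ) + (2 * k + r + 2).choose k =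
      (2 * k + r + 2).choose (k + 1) := by exact_mod_cast h
    have h2' : ((2 * k + r + 2).choose (k + 1) : ℚ) * (k + 1) =
      (2 * k + r + 2).choose k * (k + r + 2) := by exact_mod_cast h2
    have : ((k + 1 : ℕ) : ℚ) + r + 1 ≠ 0 := by positivity
    rw [show 2 * (k + 1) + r = 2 * k + r + 2 by ring]
    field_simp
    push_cast
    linear_combination (k + r + 2) * h' + h2'

/-- The list form of the notion of a Catalan word. -/
def ListCatalan (l : List ℕ) : Prop :=
  l.IsChain (fun x y => x ≤ y + 1) ∧ (∀ k p q, l = p ++ (k + 1) :: q → k ∈ p) ∧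
    ∀ k, k + 1 ∈ l → [k + 1, k].Sublist l

/-- The chain condition saying that zeros are preceded by letters at most one. -/
abbrev ZeroChain (l : List ℕ) : Prop := l.IsChain (fun x y => y = 0 → x ≤ 1)

/-- The nonzero letters of a list. -/
def nonzeros (l : List ℕ) : List ℕ := l.filter (· ≠ 0)

@[simp] theorem nonzeros_nil : nonzeros [] = [] := rfl

@[simp] theorem nonzeros_zero_cons (l : List ℕ) : nonzeros (0 :: l) = nonzeros l := by
  simp [nonzeros]

theorem nonzeros_cons_of_ne_zero {x : ℕ} (hx : x ≠ 0) (l : List ℕ) :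
    nonzeros (x :: l) = x :: nonzeros l := by
  simp [nonzeros, hx]

@[simp] theorem nonzeros_append (l l' : List ℕ) :
    nonzeros (l ++ l') = nonzeros l ++ nonzeros l' := by
  simp [nonzeros]

theorem mem_nonzeros {x : ℕ} {l : List ℕ} : x ∈ nonzeros l ↔ x ∈ l ∧ x ≠ 0 := by
  simp [nonzeros]

theorem isChain_iff_zeroChain_and_nonzeros (l : List ℕ) :
    l.IsChain (fun x y => x ≤ y + 1) ↔
      ZeroChain l ∧ (nonzeros l).IsChain (fun x y => x ≤ y + 1) := by
  induction l with
  | nil => simp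
  | cons x l ih =>
    have key : ∀ l : List ℕ, x ≤ 1 →
        ((x :: l).IsChain (fun x y => x ≤ y + 1) ↔ l.IsChain (fun x y => x ≤ y + 1)) := by
      intro l hx
      rw [List.isChain_cons]
      exact ⟨And.right, fun h => ⟨fun y _ => by omega, h⟩⟩
    rcases l with _ | ⟨y, l⟩
    · by_cases hx : x = 0 <;> simp [hx, nonzeros]
    · rw [List.isChain_cons_cons, ih, ZeroChain, ZeroChain, List.isChain_cons_cons]
      by_cases hx : x = 0
      · simp [hx]
      rw [nonzeros_cons_of_ne_zero hx]
      by_cases hy : y = 0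
      · subst hy
        rw [nonzeros_zero_cons]
        constructor
        · rintro ⟨h1, h2, h3⟩
          exact ⟨⟨fun _ => h1, h2⟩, (key _ h1).2 h3⟩
        · rintro ⟨⟨h1, h2⟩, h3⟩
          exact ⟨h1 rfl, h2, (key _ (h1 rfl)).1 h3⟩
      · rw [nonzeros_cons_of_ne_zero hy, List.isChain_cons_cons]
        tauto

theorem listCatalan_iff {l v : List ℕ} (hv : nonzeros l = v.map Nat.succ) (h1 : 1 ∈ l) :
    ListCatalan l ↔ ZeroChain l ∧ l.head? = some 0 ∧ [1, 0].Sublist l ∧ ListCatalan v := by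
  have hchain : (nonzeros l).IsChain (fun x y => x ≤ y + 1) ↔
      v.IsChain (fun x y => x ≤ y + 1) := by
    rw [hv, List.isChain_map]
    simp
  have hsub : ∀ k, [k + 2, k + 1].Sublist l ↔ [k + 1, k].Sublist v := by
    intro k
    constructor
    · intro h
      have h' := h.filter (· ≠ 0)
      change List.Sublist _ (nonzeros l) at h'
      rw [hv] at h'
      simpa [Function.comp_def] using h'.map Nat.pred
    · intro h
      have h' := h.map Nat.succ
      rw [← hv] at h'
      exact h'.trans List.filter_sublist
  have hmem : ∀ k, k + 1 ∈ v ↔ k + 2 ∈ l := by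
    intro k
    have : k + 2 ∈ nonzeros l ↔ k + 2 ∈ v.map Nat.succ := by rw [hv]
    simpa [mem_nonzeros] using this.symm
  have hhead : (∀ k p q, l = p ++ (k + 1) :: q → k ∈ p) ↔
      l.head? = some 0 ∧ (∀ k p q, v = p ++ (k + 1) :: q → k ∈ p) := by
    constructor
    · intro h
      refine ⟨?_, ?_⟩
      · rcases l with _ | ⟨_ | x, l⟩
        · simp at h1
        · rfl
        · simpa using h x [] l rfl
      · rintro k p q rfl
        rw [List.map_append, List.map_cons, nonzeros, List.filter_eq_append_iff] at hv
        obtain ⟨l₁, l₂, rfl, hp, h2⟩ := hv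
        rw [List.filter_eq_cons_iff] at h2
        obtain ⟨l₃, l₄, rfl, h3, -, -⟩ := h2
        have := h (k + 1) (l₁ ++ l₃) l₄ (by simp)
        rcases List.mem_append.1 this with h4 | h4
        · have : k + 1 ∈ l₁.filter (· ≠ 0) := by simpa using h4
          rw [hp] at this
          simpa using this
        · simpa using h3 _ h4
    · rintro ⟨h0, h⟩ k p q rfl
      rcases k with _ | k
      · rcases p with _ | ⟨x, p⟩
        · simp at h0
        · simp_all
      · rw [nonzeros_append, nonzeros_cons_of_ne_zero (by simp)] at hv
        rw [eq_comm, List.map_eq_append_iff] at hv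
        obtain ⟨v₁, v₂, rfl, hp, h2⟩ := hv
        rw [List.map_eq_cons_iff] at h2
        obtain ⟨x, v₃, rfl, hx, -⟩ := h2
        obtain rfl : x = k + 1 := by simpa using hx
        have h3 : k + 1 ∈ v₁.map Nat.succ := by simpa using h k v₁ v₃ rfl
        rw [hp] at h3
        exact (mem_nonzeros.1 h3).1
  have hlast : (∀ k, k + 1 ∈ l → [k + 1, k].Sublist l) ↔
      [1, 0].Sublist l ∧ ∀ k, k + 1 ∈ v → [k + 1, k].Sublist v := by
    constructor
    · exact fun h => ⟨h 0 h1, fun k hk => (hsub k).1 (h (k + 1) ((hmem k).1 hk))⟩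
    · rintro ⟨h, h'⟩ (_ | k) hk
      · exact h
      · exact (hsub k).2 (h' k ((hmem k).2 hk))
  rw [ListCatalan, ListCatalan, isChain_iff_zeroChain_and_nonzeros, hchain, hhead, hlast]
  tauto

/-- The ways to insert `s` zeros into the list `v` of nonzero letters, so that each zero is
preceded by a letter at most one, when the letter before the whole list is `p`. -/
def zeroInsertions (p : ℕ) (v : List ℕ) (s : ℕ) : Set (List ℕ) :=
  {l | ZeroChain (p :: l) ∧ nonzeros l = v ∧ l.count 0 = s}

theorem encard_zeroInsertions (v : List ℕ) (hv : 0 ∉ v) (p s : ℕ) :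
    (zeroInsertions p v s).encard =
      Nat.multichoose (v.count 1 + if p ≤ 1 then 1 else 0) s := by
  induction v generalizing p s with
  | nil =>
    induction s generalizing p with
    | zero =>
      have : zeroInsertions p [] 0 = {[]} := by
        ext l
        rcases l with _ | ⟨_ | x, l⟩ <;> simp [zeroInsertions, nonzeros_cons_of_ne_zero]
      simp [this]
    | succ s ih =>
      have : zeroInsertions p [] (s + 1) =
          if p ≤ 1 then List.cons 0 '' zeroInsertions 0 [] s else ∅ := by
        ext l
        split_ifs with hp
        · rcases l with _ | ⟨_ | x, l⟩ <;> simp [zeroInsertions, nonzeros_cons_of_ne_zero, hp]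
        · rcases l with _ | ⟨_ | x, l⟩ <;> simp [zeroInsertions, nonzeros_cons_of_ne_zero, hp]
      rw [this]
      split_ifs with hp
      · rw [(List.cons_injective).encard_image, ih]
        simp
      · simp
  | cons x v ihv =>
    obtain ⟨hx, hv⟩ : x ≠ 0 ∧ 0 ∉ v := by simpa [eq_comm] using hv
    have ihx : ∀ s, (List.cons x '' zeroInsertions x v s).encard =
        Nat.multichoose ((x :: v).count 1) s := by
      intro s
      rw [(List.cons_injective).encard_image, ihv hv, List.count_cons]
      congr 3
      simp only [beq_iff_eq]
      congr 1
      simp; omega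
    have hcons : ∀ p y l s, y ≠ 0 → (y :: l ∈ zeroInsertions p (x :: v) s ↔
        y :: l ∈ List.cons x '' zeroInsertions x v s) := by
      intro p y l s hy
      simp only [zeroInsertions, ZeroChain, Set.mem_ofPred_eq, List.isChain_cons_cons, hy,
        Set.mem_image, List.cons.injEq, nonzeros_cons_of_ne_zero hy, List.count_cons]
      grind
    induction s generalizing p with
    | zero =>
      have : zeroInsertions p (x :: v) 0 = List.cons x '' zeroInsertions x v 0 := by
        ext l
        rcases l with _ | ⟨_ | y, l⟩
        · simp [zeroInsertions]
        · simp only [zeroInsertions, Set.mem_ofPred_eq, Set.mem_image, List.cons.injEq, List.count_cons]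
          simp [hx]
        · exact hcons _ _ _ _ (by simp)
      rw [this, ihx]
      simp
    | succ s ih =>
      by_cases hp : p ≤ 1
      · have : zeroInsertions p (x :: v) (s + 1) =
            List.cons 0 '' zeroInsertions 0 (x :: v) s ∪
              List.cons x '' zeroInsertions x v (s + 1) := by
          ext l
          rcases l with _ | ⟨_ | y, l⟩
          · simp [zeroInsertions]
          · simp [zeroInsertions, hx, hp]
          · simpa using hcons p (y + 1) l (s + 1) (by simp)
        rw [this, Set.encard_union_eq, ihx, (List.cons_injective).encard_image, ih]
        · rw [if_pos hp, if_pos (zero_le_one' ℕ), Nat.multichoose_succ_succ, Nat.cast_add, add_comm]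
        · rw [Set.disjoint_left]
          rintro _ ⟨l, -, rfl⟩ ⟨l', -, h⟩
          simp_all
      · have : zeroInsertions p (x :: v) (s + 1) =
            List.cons x '' zeroInsertions x v (s + 1) := by
          ext l
          rcases l with _ | ⟨_ | y, l⟩
          · simp [zeroInsertions]
          · simp [zeroInsertions, hx, hp]
          · exact hcons p (y + 1) l (s + 1) (by simp)
        rw [this, ihx]
        simp [hp]

theorem one_zero_sublist_of_zero_mem {l : List ℕ} {x : ℕ} (hx : x ≠ 0)
    (hc : ZeroChain (x :: l)) (h0 : 0 ∈ l) : [1, 0].Sublist (x :: l) := by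
  induction l generalizing x with
  | nil => simp at h0
  | cons y l ih =>
    rw [ZeroChain, List.isChain_cons_cons] at hc
    by_cases hy : y = 0
    · obtain rfl : x = 1 := by have := hc.1 hy; omega
      simp [hy]
    · exact (ih hy hc.2 (by simpa [Ne.symm hy] using h0)).cons x

theorem eq_replicate_append_nonzeros {l : List ℕ} (hc : ZeroChain l)
    (h : ¬ [1, 0].Sublist l) : l = List.replicate (l.count 0) 0 ++ nonzeros l := by
  induction l with
  | nil => simp
  | cons x l ih =>
    by_cases hx : x = 0
    · subst hx
      have := ih hc.tail fun h' => h (h'.cons 0)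
      simpa [List.replicate_succ] using this
    · have h0 : 0 ∉ l := fun h0 => h (one_zero_sublist_of_zero_mem hx hc h0)
      rw [nonzeros_cons_of_ne_zero hx, List.count_eq_zero_of_not_mem (by simp [Ne.symm hx, h0])]
      simp only [List.replicate_zero, List.nil_append, nonzeros]
      rw [List.filter_eq_self.2 fun y hy => by simpa using ne_of_mem_of_not_mem hy h0]

theorem not_one_zero_sublist_replicate_append {w : List ℕ} (hw : 0 ∉ w) (s : ℕ) :
    ¬ [1, 0].Sublist (List.replicate s 0 ++ w) := by
  induction s with
  | zero => exact fun h => hw (h.subset (by simp))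
  | succ s ih =>
    rw [List.replicate_succ, List.cons_append, List.sublist_cons_iff]
    simpa using ih

theorem zeroChain_replicate_append {w : List ℕ} (hw : 0 ∉ w) (s : ℕ) :
    ZeroChain (List.replicate s 0 ++ w) := by
  induction s with
  | zero =>
    exact (List.pairwise_of_forall_mem_list fun _ _ y hy h => by simp_all).isChain
  | succ s ih =>
    rw [List.replicate_succ, List.cons_append, ZeroChain, List.isChain_cons]
    exact ⟨fun _ _ _ => zero_le_one, ih⟩

theorem nonzeros_of_zero_notMem {w : List ℕ} (hw : 0 ∉ w) : nonzeros w = w :=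
  List.filter_eq_self.2 fun y hy => by simpa using ne_of_mem_of_not_mem hy hw

theorem ncard_nonzeros_fiber {v : List ℕ} (hv : ListCatalan v) (h0 : 0 ∈ v) (s : ℕ) :
    {l | ListCatalan l ∧ l.count 0 = s + 1 ∧ nonzeros l = v.map Nat.succ}.ncard =
      Nat.multichoose (v.count 0 + 1) s - 1 := by
  have hw : 0 ∉ v.map Nat.succ := by simp
  have heq : {l | ListCatalan l ∧ l.count 0 = s + 1 ∧ nonzeros l = v.map Nat.succ} =
      (List.cons 0 '' zeroInsertions 0 (v.map Nat.succ) s) \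
        {List.replicate (s + 1) 0 ++ v.map Nat.succ} := by
    ext l
    simp only [Set.mem_ofPred_eq, Set.mem_sdiff, Set.mem_singleton_iff, Set.mem_image]
    have h1 : nonzeros l = v.map Nat.succ → 1 ∈ l := by
      intro h
      have : 1 ∈ nonzeros l := by rw [h]; simpa using h0
      exact (mem_nonzeros.1 this).1
    constructor
    · rintro ⟨hl, hs, hn⟩
      obtain ⟨hc, hh, h10, -⟩ := (listCatalan_iff hn (h1 hn)).1 hl
      rcases l with _ | ⟨x, l⟩
      · simp at hh
      obtain rfl : x = 0 := by simpa using hh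
      refine ⟨⟨l, ⟨hc, by simpa using hn, by simpa using hs⟩, rfl⟩, fun h => ?_⟩
      rw [h] at h10
      exact not_one_zero_sublist_replicate_append hw _ h10
    · rintro ⟨⟨l, ⟨hc, hn, hs⟩, rfl⟩, hne⟩
      have hn' : nonzeros (0 :: l) = v.map Nat.succ := by simpa using hn
      have hs' : (0 :: l).count 0 = s + 1 := by simpa using hs
      refine ⟨(listCatalan_iff hn' (h1 hn')).2 ⟨hc, rfl, ?_, hv⟩, hs', hn'⟩
      by_contra h
      have := eq_replicate_append_nonzeros hc h
      rw [hs', hn'] at this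
      exact hne this
  have hcard : (List.cons 0 '' zeroInsertions 0 (v.map Nat.succ) s).ncard =
      Nat.multichoose (v.count 0 + 1) s := by
    rw [Set.ncard, List.cons_injective.encard_image, encard_zeroInsertions _ hw,
      show (v.map Nat.succ).count 1 = v.count 0 from
        List.count_map_of_injective v Nat.succ Nat.succ_injective 0]
    simp
  rw [heq, Set.ncard_sdiff_singleton_of_mem, hcard]
  refine ⟨List.replicate s 0 ++ v.map Nat.succ, ⟨?_, ?_, ?_⟩, ?_⟩
  · exact zeroChain_replicate_append hw (s + 1)
  · rw [nonzeros_append, nonzeros_of_zero_notMem hw]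
    simp [nonzeros]
  · simp [List.count_eq_zero_of_not_mem hw]
  · simp [List.replicate_succ]

theorem ListCatalan.lt_length {l : List ℕ} (hl : ListCatalan l) {x : ℕ} (hx : x ∈ l) :
    x < l.length := by
  have key : ∀ x p q, l = p ++ x :: q → x ≤ p.length := by
    intro x
    induction x with
    | zero => simp
    | succ x ih =>
      rintro p q h
      obtain ⟨p₁, p₂, rfl⟩ := List.append_of_mem (hl.2.1 x p q h)
      have := ih p₁ (p₂ ++ (x + 1) :: q) (by simp [h])
      simp
      omega
  obtain ⟨p, q, rfl⟩ := List.append_of_mem hx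
  have := key x p q rfl
  simp
  omega

theorem ListCatalan.one_mem {l : List ℕ} (hl : ListCatalan l) {x : ℕ} (hx : x + 1 ∈ l) :
    1 ∈ l := by
  induction x with
  | zero => exact hx
  | succ x ih =>
    obtain ⟨p, q, rfl⟩ := List.append_of_mem hx
    exact ih (List.mem_append_left _ (hl.2.1 _ _ _ rfl))

theorem finite_listCatalan_length (n : ℕ) : {l | ListCatalan l ∧ l.length = n}.Finite := by
  refine ((List.finite_length_eq (Fin n) n).image (List.map Fin.val)).subset ?_
  rintro l ⟨hl, hn⟩
  have h : ∀ x ∈ l, x < n := fun x hx => hn ▸ hl.lt_length hx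
  lift l to List (Fin n) using h
  exact ⟨l, by simpa using hn, rfl⟩

theorem length_eq_count_zero_add_length_nonzeros (l : List ℕ) :
    l.length = l.count 0 + (nonzeros l).length := by
  induction l with
  | nil => simp
  | cons x l ih =>
    by_cases hx : x = 0
    · simp [hx, ih]; omega
    · simp [nonzeros_cons_of_ne_zero hx, hx, ih, add_assoc]

theorem count_one_le_length_nonzeros (l : List ℕ) : l.count 1 ≤ (nonzeros l).length := by
  rw [← List.count_filter (p := (· ≠ 0)) (by simp)]
  exact List.count_le_length

theorem ListCatalan.zero_mem {l : List ℕ} (hl : ListCatalan l) (h : l ≠ []) : 0 ∈ l := by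
  rcases l with _ | ⟨_ | x, l⟩
  · simp at h
  · simp
  · simpa using hl.2.1 x [] l rfl

/-- The Catalan words of length `n` with `s` zeros. -/
def zeroCountWords (n s : ℕ) : Set (List ℕ) :=
  {l | ListCatalan l ∧ l.length = n ∧ l.count 0 = s}

theorem finite_zeroCountWords (n s : ℕ) : (zeroCountWords n s).Finite :=
  (finite_listCatalan_length n).subset fun _ h => ⟨h.1, h.2.1⟩

/-- Double counting over the fibers of a map between sets. -/
theorem ncard_eq_sum_ncard_fiberwise {α β : Type*} [DecidableEq β] {A : Set α} (hA : A.Finite)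
    {f : α → β} {T : Finset β} (hf : ∀ a ∈ A, f a ∈ T) :
    A.ncard = ∑ b ∈ T, {a | a ∈ A ∧ f a = b}.ncard := by
  classical
  rw [Set.ncard_eq_toFinset_card A hA,
    Finset.card_eq_sum_card_fiberwise (f := f) (t := T) fun a ha => hf a (by simpa using ha)]
  refine Finset.sum_congr rfl fun b _ => ?_
  rw [← Set.ncard_coe_finset]
  congr 1
  ext a
  simp

theorem ncard_zeros_ones (n s t : ℕ) (ht : 0 < t) :
    {l | ListCatalan l ∧ l.length = n + (s + 1) ∧ l.count 0 = s + 1 ∧ l.count 1 = t}.ncard =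
      (Nat.multichoose (t + 1) s - 1) * (zeroCountWords n t).ncard := by
  have hsucc : ∀ l : List ℕ, ((nonzeros l).map Nat.pred).map Nat.succ = nonzeros l := by
    intro l
    rw [List.map_map]
    refine (List.map_congr_left fun x hx => ?_).trans (List.map_id _)
    exact Nat.succ_pred_eq_of_ne_zero (mem_nonzeros.1 hx).2
  have hfin : {l | ListCatalan l ∧ l.length = n + (s + 1) ∧ l.count 0 = s + 1 ∧
      l.count 1 = t}.Finite :=
    (finite_listCatalan_length _).subset fun _ h => ⟨h.1, h.2.1⟩
  have hcount : ∀ (l v : List ℕ), nonzeros l = v.map Nat.succ → v.count 0 = l.count 1 := by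
    intro l v h
    rw [← List.count_map_of_injective v Nat.succ Nat.succ_injective 0, ← h]
    exact List.count_filter (by simp)
  rw [ncard_eq_sum_ncard_fiberwise (f := fun l => (nonzeros l).map Nat.pred)
    (T := (finite_zeroCountWords n t).toFinset) hfin]
  · rw [Set.ncard_eq_toFinset_card _ (finite_zeroCountWords n t), mul_comm, ← smul_eq_mul]
    refine Finset.sum_eq_card_nsmul fun v hv => ?_
    obtain ⟨hvc, hn, rfl⟩ := (Set.Finite.mem_toFinset _).1 hv
    rw [← ncard_nonzeros_fiber hvc (List.count_pos_iff.1 ht)]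
    congr 1
    ext l
    simp only [Set.mem_ofPred_eq]
    constructor
    · rintro ⟨⟨h1, h2, h3, h4⟩, rfl⟩
      exact ⟨h1, h3, (hsucc l).symm⟩
    · rintro ⟨h1, h2, h3⟩
      have h4 := length_eq_count_zero_add_length_nonzeros l
      refine ⟨⟨h1, ?_, h2, (hcount l v h3).symm⟩, ?_⟩
      · rw [h4, h2, h3, List.length_map, hn, add_comm]
      · rw [h3]
        simp [Function.comp_def]
  · rintro l ⟨h1, h2, h3, h4⟩
    rw [Set.Finite.mem_toFinset]
    have h5 := length_eq_count_zero_add_length_nonzeros l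
    have h6 : 1 ∈ l := List.count_pos_iff.1 (h4 ▸ ht)
    refine ⟨((listCatalan_iff (hsucc l).symm h6).1 h1).2.2.2, ?_, ?_⟩
    · rw [List.length_map]
      omega
    · rw [hcount l _ (hsucc l).symm, h4]

theorem zeroCountWords_self (n : ℕ) : zeroCountWords n n = {List.replicate n 0} := by
  ext l
  rw [Set.mem_singleton_iff, List.eq_replicate_iff]
  constructor
  · rintro ⟨-, h1, h2⟩
    refine ⟨h1, fun x hx => ?_⟩
    exact ((List.count_eq_length.1 (h2.trans h1.symm)) x hx).symm
  · rintro ⟨h1, h2⟩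
    refine ⟨⟨?_, ?_, ?_⟩, h1, ?_⟩
    · refine (List.pairwise_of_forall_mem_list fun x hx _ _ => ?_).isChain
      simp [h2 x hx]
    · rintro k p q rfl
      simpa using h2 (k + 1) (by simp)
    · intro k hk
      simpa using h2 _ hk
    · rw [← h1, List.count_eq_length]
      exact fun x hx => (h2 x hx).symm

theorem ncard_zeroCountWords (r k : ℕ) :
    (zeroCountWords (r + 1 + k) (r + 1)).ncard = ballot r k := by
  induction k using Nat.strong_induction_on generalizing r with
  | _ k ih =>
  rcases k with _ | k
  · simp [zeroCountWords_self, ballot_zero_right]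
  have hone : ∀ l ∈ zeroCountWords (r + 1 + (k + 1)) (r + 1), 0 < l.count 1 := by
    rintro l ⟨h1, h2, h3⟩
    have h4 := length_eq_count_zero_add_length_nonzeros l
    obtain ⟨x, hx⟩ := List.exists_mem_of_length_pos (l := nonzeros l) (by omega)
    obtain ⟨hx, hx0⟩ := mem_nonzeros.1 hx
    obtain ⟨x, rfl⟩ := Nat.exists_eq_succ_of_ne_zero hx0
    exact List.count_pos_iff.2 (h1.one_mem hx)
  rw [ncard_eq_sum_ncard_fiberwise (f := fun l => l.count 1 - 1) (T := Finset.range (k + 1))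
    (finite_zeroCountWords _ _), ← sum_multichoose_sub_one_mul_ballot]
  · refine Finset.sum_congr rfl fun p hp => ?_
    have hp : p ≤ k := Nat.lt_succ_iff.1 (Finset.mem_range.1 hp)
    rw [← ih (k - p) (by omega), show p + 1 + (k - p) = k + 1 by omega,
      ← ncard_zeros_ones (k + 1) r (p + 1) (by omega)]
    congr 1
    ext l
    constructor
    · rintro ⟨h, h'⟩
      have := hone l h
      obtain ⟨h1, h2, h3⟩ := h
      exact ⟨h1, by omega, h3, by omega⟩
    · rintro ⟨h1, h2, h3, h4⟩
      exact ⟨⟨h1, by omega, h3⟩, by simp [h4]⟩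
  · rintro l hl
    have := hone l hl
    obtain ⟨h1, h2, h3⟩ := hl
    have h4 := length_eq_count_zero_add_length_nonzeros l
    have h5 := count_one_le_length_nonzeros l
    rw [Finset.mem_range]
    omega

theorem ncard_oneCountWords (n m : ℕ) (hm : 0 < m) :
    {l | ListCatalan l ∧ l.length = n ∧ l.count 1 = m}.ncard =
      ∑ j ∈ Finset.Icc m (n - 1), (Nat.choose j m - 1) * ballot (m - 1) (n - j - 1) := by
  rw [ncard_eq_sum_ncard_fiberwise (f := fun l => l.count 0 + m - 1)
    (T := Finset.Icc m (n - 1)) ((finite_listCatalan_length n).subset fun _ h => ⟨h.1, h.2.1⟩)]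
  · refine Finset.sum_congr rfl fun j hj => ?_
    obtain ⟨hj1, hj2⟩ := Finset.mem_Icc.1 hj
    have h := ncard_zeros_ones (m + (n - j - 1)) (j - m) m hm
    have h' := ncard_zeroCountWords (m - 1) (n - j - 1)
    rw [Nat.sub_add_cancel hm] at h'
    rw [h', Nat.multichoose_eq, show m + 1 + (j - m) - 1 = j by omega,
      Nat.choose_symm hj1] at h
    rw [← h]
    congr 1
    ext l
    constructor
    · rintro ⟨⟨h1, h2, h3⟩, h4⟩
      exact ⟨h1, by omega, by omega, h3⟩
    · rintro ⟨h1, h2, h3, h4⟩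
      exact ⟨⟨h1, by omega, h4⟩, by omega⟩
  · rintro l ⟨h1, h2, h3⟩
    have h4 := length_eq_count_zero_add_length_nonzeros l
    have h5 := count_one_le_length_nonzeros l
    have h6 : 0 < l.count 0 := List.count_pos_iff.2 (h1.zero_mem (by rintro rfl; simp at h3; omega))
    rw [Finset.mem_Icc]
    omega

theorem countEq_eq_count_ofFn {n : ℕ} (a : Fin n → ℕ) (c : ℕ) :
    countEq a c = (List.ofFn a).count c := by
  have h := Fin.card_filter_univ_eq_vector_get_eq_count c (List.Vector.ofFn a)
  rw [List.Vector.toList_ofFn] at h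
  rw [← h, countEq, ← Set.ncard_coe_finset]
  congr 1
  ext i
  simp

theorem isCatalanWord_iff_listCatalan_ofFn {n : ℕ} (a : Fin n → ℕ) :
    IsCatalanWord a ↔ ListCatalan (List.ofFn a) := by
  rw [IsCatalanWord, ListCatalan, List.isChain_iff_getElem]
  refine and_congr (by simp) ?_
  have hsplit : ∀ i : Fin n, List.ofFn a =
      (List.ofFn a).take i ++ a i :: (List.ofFn a).drop (i + 1) := by
    intro i
    have : a i = (List.ofFn a)[(i : ℕ)]'(by simp) := by simp
    rw [this, ← List.drop_eq_getElem_cons, List.take_append_drop]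
  have htake : ∀ (i : Fin n) (k : ℕ),
      k ∈ (List.ofFn a).take i ↔ ∃ j : Fin n, j < i ∧ a j = k := by
    intro i k
    rw [List.mem_take_iff_getElem]
    constructor
    · rintro ⟨j, hj, h⟩
      simp only [List.length_ofFn, lt_min_iff] at hj
      exact ⟨⟨j, hj.2⟩, hj.1, by simpa using h⟩
    · rintro ⟨j, hj, h⟩
      exact ⟨j, by simp only [List.length_ofFn, lt_min_iff]; omega, by simpa using h⟩
  have hdrop : ∀ (i : Fin n) (k : ℕ),
      k ∈ (List.ofFn a).drop (i + 1) ↔ ∃ j : Fin n, i < j ∧ a j = k := by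
    intro i k
    rw [List.mem_drop_iff_getElem]
    constructor
    · rintro ⟨j, hj, h⟩
      simp only [List.length_ofFn] at hj
      exact ⟨⟨j + (i + 1), hj⟩, by simp only [Fin.lt_def]; omega, by simpa [add_comm] using h⟩
    · rintro ⟨j, hj, h⟩
      have hj : (i : ℕ) < j := hj
      refine ⟨j - (i + 1), by simp only [List.length_ofFn]; omega, ?_⟩
      simpa [show (i : ℕ) + 1 + (j - (i + 1)) = j by omega,
        show (j : ℕ) - (i + 1) + (i + 1) = j by omega] using h
  constructor
  · intro h
    have hfirst : ∀ i : Fin n, ∃ i₀ ≤ i, a i₀ = a i ∧ ∀ j, a j = a i → i₀ ≤ j := by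
      intro i
      have hne : (Finset.univ.filter fun j => a j = a i).Nonempty := ⟨i, by simp⟩
      refine ⟨Finset.min' _ hne, Finset.min'_le _ _ (by simp), ?_, fun j hj =>
        Finset.min'_le _ _ (by simpa using hj)⟩
      simpa using Finset.min'_mem _ hne
    constructor
    · intro k p q hpq
      have hlt : p.length < n := by
        have := congrArg List.length hpq
        simp at this
        omega
      have hi : a ⟨p.length, hlt⟩ = k + 1 := by
        have : (List.ofFn a)[p.length]'(by simpa using hlt) = k + 1 := by simp [hpq]
        simpa using this
      obtain ⟨i₀, hle, h0, hmin⟩ := hfirst ⟨p.length, hlt⟩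
      obtain ⟨⟨i₁, h1, h1'⟩, -⟩ := h i₀ (by omega) (by rwa [h0])
      have := (htake ⟨p.length, hlt⟩ k).2 ⟨i₁, lt_of_lt_of_le h1 hle, by omega⟩
      simpa [hpq] using this
    · intro k hk
      obtain ⟨i, hi⟩ := (List.mem_ofFn' a _).1 hk
      obtain ⟨i₀, -, h0, hmin⟩ := hfirst i
      obtain ⟨-, i₂, h2, h2'⟩ := h i₀ (by omega) (by rwa [h0])
      rw [hsplit i₀, h0, hi]
      refine List.Sublist.trans ?_ (List.sublist_append_right _ _)
      rw [List.cons_sublist_cons, List.singleton_sublist, hdrop]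
      exact ⟨i₂, h2, by omega⟩
  · rintro ⟨h1, h2⟩ i hpos hmin
    obtain ⟨k, hk⟩ := Nat.exists_eq_succ_of_ne_zero hpos.ne'
    have hi := hsplit i
    rw [hk] at hi
    constructor
    · obtain ⟨j, hj, hj'⟩ := (htake i k).1 (h1 k _ _ hi)
      exact ⟨j, hj, by omega⟩
    · have hs := h2 k (by rw [hi]; simp)
      have hnot : k + 1 ∉ (List.ofFn a).take i := by
        rw [htake]
        rintro ⟨j, hj, hj'⟩
        exact absurd (hmin j (by omega)) (not_le.2 hj)
      rw [hi, List.sublist_append_iff] at hs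
      obtain ⟨l₁, l₂, hl, hl₁, hl₂⟩ := hs
      rcases l₁ with _ | ⟨x, l₁⟩
      · rw [List.nil_append] at hl
        rw [← hl, List.cons_sublist_cons, List.singleton_sublist, hdrop] at hl₂
        obtain ⟨j, hj, hj'⟩ := hl₂
        exact ⟨j, hj, by omega⟩
      · obtain ⟨rfl, -⟩ := List.cons.inj hl
        exact absurd (hl₁.subset (by simp)) hnot

theorem bO_eq_ncard_list (n m : ℕ) :
    bO n m = {l | ListCatalan l ∧ l.length = n ∧ l.count 1 = m}.ncard := by
  rw [bO, ← Set.ncard_image_of_injective _ (List.ofFn_injective (n := n))]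
  congr 1
  ext l
  constructor
  · rintro ⟨a, ⟨h1, h2⟩, rfl⟩
    exact ⟨(isCatalanWord_iff_listCatalan_ofFn a).1 h1, by simp, by
      rwa [← countEq_eq_count_ofFn]⟩
  · rintro ⟨h1, rfl, h3⟩
    have h : List.ofFn l.get = l := List.ofFn_get l
    refine ⟨l.get, ⟨(isCatalanWord_iff_listCatalan_ofFn _).2 (by rwa [h]), ?_⟩, h⟩
    rwa [countEq_eq_count_ofFn, h]

/-- Explicit formula (in `ℚ`) for the number of Catalan words of length `n` with `m` ones:
`b(n,m) = Σ_{j=m}^{n-1} ((m-1)/(n+m-j-2))·C(2n+m-2j-4, n-j-1)·(C(j,m) - 1)`. -/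
theorem bO_formula (n m : ℕ) (hm : 2 ≤ m) (hmn : m ≤ n - 2) :
    (bO n m : ℚ) = ∑ j ∈ Finset.Icc m (n - 1),
      ((m : ℚ) - 1) / ((n : ℚ) + (m : ℚ) - (j : ℚ) - 2) *
        (Nat.choose (2 * n + m - 2 * j - 4) (n - j - 1) : ℚ) *
        ((Nat.choose j m : ℚ) - 1) := by
  rw [bO_eq_ncard_list, ncard_oneCountWords n m (by omega), Nat.cast_sum]
  refine Finset.sum_congr rfl fun j hj => ?_
  obtain ⟨hj1, hj2⟩ := Finset.mem_Icc.1 hj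
  obtain ⟨r, rfl⟩ := Nat.exists_eq_add_of_le' hm
  obtain ⟨k, hk⟩ : ∃ k, n = j + 1 + k := Nat.exists_eq_add_of_le (by omega)
  have hpos : 1 ≤ Nat.choose j (r + 2) := Nat.choose_pos hj1
  rw [show r + 2 - 1 = r + 1 by omega, show n - j - 1 = k by omega,
    show 2 * n + (r + 2) - 2 * j - 4 = 2 * k + r by omega, Nat.cast_mul, ballot_succ_cast,
    Nat.cast_sub hpos, hk, mul_comm]
  push_cast
  congr 3 <;> ring
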